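/- Suppose that for some cardinal κ and some n ∈ ℕ there exist a very-large family B of finite subsets of κ and a function c : B → ℕ such that any two distinct s, t ∈ B with c(s) = c(t) are in n-Δ-position. Then there is a norm ‖·‖ on c₀₀(κ) (the real vector space of finitely supported functions κ → ℝ) such that, writing (u_γ)_{γ<κ} for the unit vectors: (i) ‖u_γ‖ = 1 for every γ; (ii) there is a constant K ≥ 1 such that ‖Σ_{α<λ} a_α u_α‖ ≤ K·‖Σ_{α<κ} a_α u_α‖ for every λ < κ and every finitely supported family of scalars (a_α)_{α<κ} (so (u_γ)_{γ<κ} is a Schauder basic sequence); (iii) the sequence is weakly null: for every linear functional f on c₀₀(κ) bounded with respect to ‖·‖ and every ε > 0, the set {γ < κ : |f(u_γ)| ≥ ε} is finite; and (iv) no infinite subsequence is unconditional: for every infinite A ⊆ κ and every constant L ≥ 1 there are a finite set s ⊆ A, scalars (a_γ)_{γ∈s}, and a subset t ⊆ s with ‖Σ_{γ∈t} a_γ u_γ‖ > L·‖Σ_{γ∈s} a_γ u_γ‖. -/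

import Mathlib

open scoped Classical

/-- `s < t` for finite sets of ordinals. -/
def BlkLt (s t : Finset Ordinal) : Prop := ∀ a ∈ s, ∀ b ∈ t, a < b

/-- `s ⊑ t` : `s` is an initial part of `t`. -/
def InitSeg (s t : Finset Ordinal) : Prop := s ⊆ t ∧ BlkLt s (t \ s)

/-- `A` and `B` are in `n`-Δ-position. -/
def DeltaPos (n : ℕ) (A B : Finset Ordinal) : Prop :=
  ∃ I J : Finset Ordinal, I ⊆ A ∩ B ∧ J ⊆ A ∩ B ∧ BlkLt I J ∧
    A ∩ B = I ∪ J ∧ J.card ≤ n ∧ InitSeg I A ∧ InitSeg I B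

/-- A very-large family of finite subsets of the ordinals below `κo`. -/
def VeryLarge (κo : Ordinal) (B : Set (Finset Ordinal)) : Prop :=
  ∀ A : Set Ordinal, A ⊆ Set.Iio κo → A.Infinite →
    ∃ A' ⊆ A, A'.Infinite ∧ ∀ s : Finset Ordinal, ↑s ⊆ A' → s ∈ B

open Finset

/-! ### Initial segments of finite sets of ordinals -/

theorem InitSeg.trans {s t u : Finset Ordinal} (hst : InitSeg s t) (htu : InitSeg t u) :
    InitSeg s u := by
  refine ⟨hst.1.trans htu.1, fun a ha b hb => ?_⟩
  rw [mem_sdiff] at hb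
  by_cases hbt : b ∈ t
  · exact hst.2 a ha b (mem_sdiff.2 ⟨hbt, hb.2⟩)
  · exact htu.2 a (hst.1 ha) b (mem_sdiff.2 ⟨hb.1, hbt⟩)

theorem InitSeg.refl (s : Finset Ordinal) : InitSeg s s :=
  ⟨Subset.rfl, fun a _ b hb => absurd hb (by simp)⟩

theorem InitSeg.empty_left (s : Finset Ordinal) : InitSeg ∅ s :=
  ⟨empty_subset s, fun a ha => absurd ha (by simp)⟩

theorem InitSeg.filter_lt {s t : Finset Ordinal} (h : InitSeg s t) (lam : Ordinal) :
    InitSeg (s.filter (· < lam)) t := by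
  refine ⟨(filter_subset _ _).trans h.1, fun a ha b hb => ?_⟩
  rw [mem_filter] at ha
  rw [mem_sdiff, mem_filter] at hb
  by_cases hbs : b ∈ s
  · exact ha.2.trans_le (not_lt.1 fun hlt => hb.2 ⟨hbs, hlt⟩)
  · exact h.2 a ha.1 b (mem_sdiff.2 ⟨hb.1, hbs⟩)

theorem InitSeg.subset_of_mem {s s' t : Finset Ordinal} (h : InitSeg s t) (h' : InitSeg s' t)
    {x : Ordinal} (hx : x ∈ s') (hxs : x ∉ s) : s ⊆ s' := by
  intro y hy
  by_contra hys
  have h1 := h.2 y hy x (mem_sdiff.2 ⟨h'.1 hx, hxs⟩)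
  have h2 := h'.2 x hx y (mem_sdiff.2 ⟨h.1 hy, hys⟩)
  exact lt_asymm h1 h2

theorem InitSeg.eq_of_card_eq {s s' t : Finset Ordinal} (h : InitSeg s t) (h' : InitSeg s' t)
    (hcard : s.card = s'.card) : s = s' := by
  by_cases hsub : s' ⊆ s
  · exact (eq_of_subset_of_card_le hsub hcard.le).symm
  · obtain ⟨x, hx, hxs⟩ := not_subset.1 hsub
    exact eq_of_subset_of_card_le (h.subset_of_mem h' hx hxs) hcard.ge

theorem InitSeg.of_subset {s s' t : Finset Ordinal} (h : InitSeg s t) (hs : s ⊆ s')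
    (ht : s' ⊆ t) : InitSeg s s' :=
  ⟨hs, fun a ha b hb => h.2 a ha b (sdiff_subset_sdiff ht Subset.rfl hb)⟩

theorem DeltaPos.refl (n : ℕ) (s : Finset Ordinal) : DeltaPos n s s :=
  ⟨s, ∅, by simp, by simp, fun a _ b hb => absurd hb (by simp), by simp, by simp,
    InitSeg.refl s, InitSeg.refl s⟩

/-! ### Special chains -/

/-- An increasing chain `∅ = U 0 ⊑ U 1 ⊑ ⋯ ⊑ U k` in which the size of each block
`U (i + 1) \ U i` is determined by the code `h (U i)`. -/
structure SpecialChain (B : Set (Finset Ordinal)) (h : Finset Ordinal → ℕ)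
    (U : ℕ → Finset Ordinal) (k : ℕ) : Prop where
  zero : U 0 = ∅
  init : ∀ i < k, InitSeg (U i) (U (i + 1))
  card : ∀ i < k, (U (i + 1) \ U i).card = 16 ^ (h (U i) ^ 2)
  mem : ∀ i < k, U i ∈ B

/-- The function equal to `e i * 4 ^ (-(h (U i)) ^ 2)` on the `i`-th block of the chain `U`. -/
noncomputable def chainFun (h : Finset Ordinal → ℕ) (U : ℕ → Finset Ordinal) (k : ℕ)
    (e : ℕ → ℝ) (γ : Ordinal) : ℝ :=
  ∑ i ∈ range k, if γ ∈ U (i + 1) \ U i then e i * (1 / 4) ^ (h (U i) ^ 2) else 0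

namespace SpecialChain

variable {B : Set (Finset Ordinal)} {h : Finset Ordinal → ℕ} {U V : ℕ → Finset Ordinal}
  {k l : ℕ}

theorem initSeg (hU : SpecialChain B h U k) {i j : ℕ} (hij : i ≤ j) (hj : j ≤ k) :
    InitSeg (U i) (U j) := by
  induction j, hij using Nat.le_induction with
  | base => exact InitSeg.refl _
  | succ j _ ih => exact (ih (by omega)).trans (hU.init j (by omega))

theorem card_succ (hU : SpecialChain B h U k) {i : ℕ} (hi : i < k) :
    (U (i + 1)).card = (U i).card + 16 ^ (h (U i) ^ 2) := by
  rw [← hU.card i hi, add_comm (U i).card, card_sdiff_add_card_eq_card (hU.init i hi).1]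

theorem exists_mem_block (hU : SpecialChain B h U k) {γ : Ordinal} :
    ∀ {j : ℕ}, γ ∈ U j → ∃ i < j, γ ∈ U (i + 1) \ U i
  | 0, hγ => by simp [hU.zero] at hγ
  | j + 1, hγ => by
    by_cases hj : γ ∈ U j
    · obtain ⟨i, hi, hm⟩ := hU.exists_mem_block hj
      exact ⟨i, by omega, hm⟩
    · exact ⟨j, by omega, mem_sdiff.2 ⟨hγ, hj⟩⟩

theorem block_unique (hU : SpecialChain B h U k) {γ : Ordinal} {i j : ℕ} (hi : i < k)
    (hj : j < k) (hγi : γ ∈ U (i + 1) \ U i) (hγj : γ ∈ U (j + 1) \ U j) : i = j := by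
  rw [mem_sdiff] at hγi hγj
  rcases lt_trichotomy i j with hlt | heq | hlt
  · exact absurd ((hU.initSeg (Nat.succ_le_of_lt hlt) hj.le).1 hγi.1) hγj.2
  · exact heq
  · exact absurd ((hU.initSeg (Nat.succ_le_of_lt hlt) hi.le).1 hγj.1) hγi.2

theorem chainFun_eq (hU : SpecialChain B h U k) (e : ℕ → ℝ) {γ : Ordinal} {i : ℕ} (hi : i < k)
    (hγ : γ ∈ U (i + 1) \ U i) : chainFun h U k e γ = e i * (1 / 4) ^ (h (U i) ^ 2) := by
  unfold chainFun
  rw [sum_eq_single_of_mem i (mem_range.2 hi), if_pos hγ]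
  intro j hj hne
  rw [if_neg]
  exact fun hγj => hne (hU.block_unique (mem_range.1 hj) hi hγj hγ)

theorem chainFun_eq_zero (hU : SpecialChain B h U k) (e : ℕ → ℝ) {γ : Ordinal}
    (hγ : γ ∉ U k) : chainFun h U k e γ = 0 := by
  unfold chainFun
  refine sum_eq_zero fun i hi => if_neg fun hm => hγ ?_
  exact (hU.initSeg (Nat.succ_le_of_lt (mem_range.1 hi)) le_rfl).1 (mem_sdiff.1 hm).1

theorem abs_chainFun_le_one (hU : SpecialChain B h U k) {e : ℕ → ℝ} (he : ∀ i, |e i| ≤ 1)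
    (γ : Ordinal) : |chainFun h U k e γ| ≤ 1 := by
  by_cases hγ : γ ∈ U k
  · obtain ⟨i, hi, hm⟩ := hU.exists_mem_block hγ
    rw [hU.chainFun_eq e hi hm, abs_mul, abs_of_nonneg (by positivity : (0 : ℝ) ≤ (1 / 4) ^ _)]
    exact mul_le_one₀ (he i) (by positivity) (pow_le_one₀ (by norm_num) (by norm_num))
  · simp [hU.chainFun_eq_zero e hγ]

theorem code_lt_succ (hU : SpecialChain B h U k) (hh : ∀ s, s.card ≤ h s) {i : ℕ} (hi : i < k) :
    h (U i) < h (U (i + 1)) := by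
  calc h (U i) ≤ h (U i) ^ 2 := Nat.le_self_pow two_ne_zero _
    _ < 16 ^ (h (U i) ^ 2) := Nat.lt_pow_self (by norm_num)
    _ ≤ (U (i + 1)).card := by rw [hU.card_succ hi]; omega
    _ ≤ h (U (i + 1)) := hh _

theorem code_lt (hU : SpecialChain B h U k) (hh : ∀ s, s.card ≤ h s) {i j : ℕ} (hij : i < j)
    (hj : j ≤ k) : h (U i) < h (U j) := by
  induction j, hij using Nat.le_induction with
  | base => exact hU.code_lt_succ hh (by omega)
  | succ j _ ih => exact (ih (by omega)).trans (hU.code_lt_succ hh (by omega))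

theorem le_code (hU : SpecialChain B h U k) (hh : ∀ s, s.card ≤ h s) :
    ∀ {i : ℕ}, i ≤ k → i ≤ h (U i)
  | 0, _ => Nat.zero_le _
  | i + 1, hi => (hU.le_code hh (by omega : i ≤ k)).trans_lt (hU.code_lt_succ hh hi)

theorem sum_pow_code_le (hU : SpecialChain B h U k) (hh : ∀ s, s.card ≤ h s) :
    ∑ i ∈ range k, (1 / 2 : ℝ) ^ h (U i) ≤ 2 := by
  calc ∑ i ∈ range k, (1 / 2 : ℝ) ^ h (U i) ≤ ∑ i ∈ range k, (1 / 2 : ℝ) ^ i :=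
        sum_le_sum fun i hi => pow_le_pow_of_le_one (by norm_num) (by norm_num)
          (hU.le_code hh (mem_range.1 hi).le)
    _ ≤ 2 := sum_geometric_two_le k

/-- Two special chains agree along a common initial segment. -/
theorem eq_of_initSeg (hU : SpecialChain B h U k) (hV : SpecialChain B h V l)
    {W : Finset Ordinal} (hWU : InitSeg W (U k)) (hWV : InitSeg W (V l)) {γ : Ordinal}
    (hγ : γ ∈ W) : ∀ {i : ℕ}, i ≤ k → γ ∉ U i → i < l ∧ U i = V i
  | 0, _, _ => by
    refine ⟨Nat.pos_of_ne_zero fun h0 => ?_, by rw [hU.zero, hV.zero]⟩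
    have := hWV.1 hγ
    simp [h0, hV.zero] at this
  | i + 1, hi, hγi => by
    obtain ⟨hil, heq⟩ := hU.eq_of_initSeg hV hWU hWV hγ (by omega : i ≤ k)
      fun hm => hγi ((hU.init i hi).1 hm)
    have hUW : U (i + 1) ⊆ W := (hU.initSeg hi le_rfl).subset_of_mem hWU hγ hγi
    have hUV : InitSeg (U (i + 1)) (V l) :=
      ((hU.initSeg hi le_rfl).of_subset hUW hWU.1).trans hWV
    have hEq : U (i + 1) = V (i + 1) := by
      refine hUV.eq_of_card_eq (hV.initSeg hil le_rfl) ?_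
      rw [hU.card_succ hi, hV.card_succ hil, heq]
    refine ⟨lt_of_le_of_ne hil fun hl => hγi ?_, hEq⟩
    rw [hEq, hl]
    exact hWV.1 hγ

theorem chainFun_eq_of_initSeg (hU : SpecialChain B h U k) (hV : SpecialChain B h V l)
    {W : Finset Ordinal} (hWU : InitSeg W (U k)) (hWV : InitSeg W (V l)) (e : ℕ → ℝ)
    {γ : Ordinal} (hγ : γ ∈ W) : chainFun h V l e γ = chainFun h U k e γ := by
  obtain ⟨i, hi, hm⟩ := hU.exists_mem_block (hWU.1 hγ)
  obtain ⟨j, hj, hm'⟩ := hV.exists_mem_block (hWV.1 hγ)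
  have hUi := hU.eq_of_initSeg hV hWU hWV hγ hi.le (mem_sdiff.1 hm).2
  have hVj := hV.eq_of_initSeg hU hWV hWU hγ hj.le (mem_sdiff.1 hm').2
  have hij : i = j := by
    rcases lt_trichotomy i j with hlt | heq | hlt
    · exfalso
      have := (hU.initSeg (Nat.succ_le_of_lt hlt) hVj.1.le).1 (mem_sdiff.1 hm).1
      rw [← hVj.2] at this
      exact (mem_sdiff.1 hm').2 this
    · exact heq
    · exfalso
      have := (hV.initSeg (Nat.succ_le_of_lt hlt) hUi.1.le).1 (mem_sdiff.1 hm').1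
      rw [← hUi.2] at this
      exact (mem_sdiff.1 hm).2 this
  subst hij
  rw [hU.chainFun_eq e hi hm, hV.chainFun_eq e hj hm', hUi.2]

end SpecialChain

theorem alternating_sum_mem_Icc (k : ℕ) : ∀ f : ℕ → ℝ, (∀ i < k, 0 ≤ f i) →
    (∀ i, i + 1 < k → f (i + 1) ≤ f i) → 0 < k →
    0 ≤ ∑ i ∈ range k, (-1) ^ i * f i ∧ ∑ i ∈ range k, (-1) ^ i * f i ≤ f 0 := by
  induction k with
  | zero => intro f _ _ hk; omega
  | succ k ih =>
    intro f h0 hf _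
    rw [sum_range_succ']
    rcases Nat.eq_zero_or_pos k with rfl | hk
    · simpa using h0 0 (by omega)
    · have := ih (fun i => f (i + 1)) (fun i hi => h0 _ (by omega))
        (fun i hi => hf _ (by omega)) hk
      have h1 := hf 0 (by omega)
      simp only [pow_succ, mul_neg, mul_one, neg_mul, sum_neg_distrib, pow_zero, one_mul]
      simp only [zero_add] at this h1 ⊢
      constructor <;> linarith [this.1, this.2]

namespace SpecialChain

variable {B : Set (Finset Ordinal)} {h : Finset Ordinal → ℕ} {U V : ℕ → Finset Ordinal}
  {k l : ℕ}

theorem abs_sum_initSeg_le (hU : SpecialChain B h U k) (hV : SpecialChain B h V l)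
    {W : Finset Ordinal} (hWU : InitSeg W (U k)) (hWV : InitSeg W (V l)) :
    |∑ γ ∈ W, chainFun h U k (fun i => (-1) ^ i) γ * chainFun h V l 1 γ| ≤ 1 := by
  set f : ℕ → ℝ := fun i =>
    ((W.filter (· ∈ U (i + 1) \ U i)).card : ℝ) * (1 / 16) ^ (h (U i) ^ 2) with hf
  have hsum : ∑ γ ∈ W, chainFun h U k (fun i => (-1) ^ i) γ * chainFun h V l 1 γ =
      ∑ i ∈ range k, (-1) ^ i * f i := by
    calc _ = ∑ γ ∈ W, ∑ i ∈ range k, if γ ∈ U (i + 1) \ U i then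
          (-1) ^ i * (1 / 16 : ℝ) ^ (h (U i) ^ 2) else 0 := by
          refine sum_congr rfl fun γ hγ => ?_
          obtain ⟨i, hi, hm⟩ := hU.exists_mem_block (hWU.1 hγ)
          rw [hU.chainFun_eq_of_initSeg hV hWU hWV 1 hγ, hU.chainFun_eq _ hi hm,
            hU.chainFun_eq _ hi hm, sum_eq_single_of_mem i (mem_range.2 hi), if_pos hm]
          · rw [Pi.one_apply, one_mul, mul_assoc, ← mul_pow]
            norm_num
          · exact fun j hj hne => if_neg fun hγj =>
              hne (hU.block_unique (mem_range.1 hj) hi hγj hm)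
      _ = _ := by
          rw [sum_comm]
          refine sum_congr rfl fun i _ => ?_
          rw [← sum_filter, sum_const, nsmul_eq_mul, hf]
          ring
  have hone : ∀ i, (16 : ℝ) ^ (h (U i) ^ 2) * (1 / 16) ^ (h (U i) ^ 2) = 1 := fun i => by
    rw [← mul_pow]; norm_num
  have hf1 : ∀ i < k, f i ≤ 1 := fun i hi => by
    rw [← hone i]
    refine mul_le_mul_of_nonneg_right ?_ (by positivity)
    have : (W.filter (· ∈ U (i + 1) \ U i)).card ≤ 16 ^ (h (U i) ^ 2) := by
      rw [← hU.card i hi]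
      exact card_le_card fun x hx => (mem_filter.1 hx).2
    exact_mod_cast this
  have hf0 : ∀ i, 0 ≤ f i := fun i => by positivity
  have hanti : ∀ i, i + 1 < k → f (i + 1) ≤ f i := by
    intro i hi
    rcases (W.filter (· ∈ U (i + 1 + 1) \ U (i + 1))).eq_empty_or_nonempty with h0 | ⟨x, hx⟩
    · have : f (i + 1) = 0 := by simp only [hf, h0]; simp
      rw [this]; exact hf0 i
    · rw [mem_filter, mem_sdiff] at hx
      have hsub : U (i + 1) ⊆ W :=
        (hU.initSeg hi.le le_rfl).subset_of_mem hWU hx.1 hx.2.2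
      have : f i = 1 := by
        have : W.filter (· ∈ U (i + 1) \ U i) = U (i + 1) \ U i := by
          ext y
          simp only [mem_filter, mem_sdiff, and_iff_right_iff_imp]
          exact fun hy => hsub hy.1
        simp only [hf]
        rw [this, hU.card i (by omega)]
        push_cast
        exact hone i
      rw [this]; exact hf1 _ hi
  rw [hsum]
  rcases Nat.eq_zero_or_pos k with rfl | hk
  · simp
  · have := alternating_sum_mem_Icc k f (fun i _ => hf0 i) hanti hk
    rw [abs_of_nonneg this.1]
    exact this.2.trans (hf1 0 hk)

/-- Outside a common initial segment `W`, a set `J` of bounded size and a set `S` of bounded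
weight, blocks of two special chains meet only when their codes differ. -/
theorem exists_cover {n : ℕ} (hU : SpecialChain B h U k) (hV : SpecialChain B h V l)
    (hh : ∀ s, s.card ≤ h s) (hd : ∀ s ∈ B, ∀ t ∈ B, h s = h t → DeltaPos n s t) :
    ∃ W J S : Finset Ordinal, InitSeg W (U k) ∧ InitSeg W (V l) ∧ J.card ≤ n ∧
      ∑ γ ∈ S, |chainFun h U k (fun i => (-1) ^ i) γ * chainFun h V l 1 γ| ≤ 1 ∧
      ∀ i < k, ∀ j < l, h (U i) = h (V j) → ∀ γ ∈ U (i + 1) \ U i, γ ∈ V (j + 1) \ V j →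
        γ ∈ W ∨ γ ∈ J ∨ γ ∈ S := by
  set M := (range k).filter fun i => ∃ j < l, h (U i) = h (V j) with hM
  rcases M.eq_empty_or_nonempty with h0 | hne
  · refine ⟨∅, ∅, ∅, InitSeg.empty_left _, InitSeg.empty_left _, by simp, by simp, ?_⟩
    intro i hi j hj hij
    have : i ∈ M := mem_filter.2 ⟨mem_range.2 hi, j, hj, hij⟩
    simp [h0] at this
  · obtain ⟨hik, j, hjl, hij⟩ := mem_filter.1 (M.max'_mem hne)
    set i := M.max' hne with hi
    rw [mem_range] at hik
    obtain ⟨I, J, -, -, -, hIJ, hJ, hIU, hIV⟩ := hd _ (hU.mem i hik) _ (hV.mem j hjl) hij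
    refine ⟨I, J, (U (i + 1) \ U i) ∩ (V (j + 1) \ V j), hIU.trans (hU.initSeg hik.le le_rfl),
      hIV.trans (hV.initSeg hjl.le le_rfl), hJ, ?_, ?_⟩
    · calc _ = ∑ γ ∈ (U (i + 1) \ U i) ∩ (V (j + 1) \ V j), (1 / 16 : ℝ) ^ (h (U i) ^ 2) := by
            refine sum_congr rfl fun γ hγ => ?_
            rw [mem_inter] at hγ
            rw [hU.chainFun_eq _ hik hγ.1, hV.chainFun_eq _ hjl hγ.2, ← hij]
            rw [Pi.one_apply, one_mul, mul_assoc, ← mul_pow, abs_mul, abs_pow, abs_neg, abs_one,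
              one_pow, one_mul, abs_of_nonneg (by positivity)]
            norm_num
        _ ≤ (16 : ℝ) ^ (h (U i) ^ 2) * (1 / 16) ^ (h (U i) ^ 2) := by
            rw [sum_const, nsmul_eq_mul]
            refine mul_le_mul_of_nonneg_right ?_ (by positivity)
            have := card_le_card (inter_subset_left (s₁ := U (i + 1) \ U i)
              (s₂ := V (j + 1) \ V j))
            rw [hU.card i hik] at this
            exact_mod_cast this
        _ = 1 := by rw [← mul_pow]; norm_num
    · intro a ha b hb hab γ hγa hγb
      have hai : a ≤ i := M.le_max' a (mem_filter.2 ⟨mem_range.2 ha, b, hb, hab⟩)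
      rcases hai.eq_or_lt with rfl | hlt
      · have hbj : b = j := by
          rcases lt_trichotomy b j with hlt | heq | hlt
          · have := hV.code_lt hh hlt hjl.le; omega
          · exact heq
          · have := hV.code_lt hh hlt hb.le; omega
        rw [hbj] at hγb
        exact Or.inr (Or.inr (mem_inter.2 ⟨hγa, hγb⟩))
      · have hbj : b < j := by
          by_contra hjb
          have h1 := hU.code_lt hh hlt hik.le
          rcases (not_lt.1 hjb).eq_or_lt with heq | hlt'
          · rw [heq] at hij; omega
          · have := hV.code_lt hh hlt' hb.le; omega
        have hγ : γ ∈ U i ∩ V j := mem_inter.2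
          ⟨(hU.initSeg (Nat.succ_le_of_lt hlt) hik.le).1 (mem_sdiff.1 hγa).1,
            (hV.initSeg (Nat.succ_le_of_lt hbj) hjl.le).1 (mem_sdiff.1 hγb).1⟩
        rw [hIJ, mem_union] at hγ
        exact hγ.imp_right Or.inl

end SpecialChain

theorem pow_mul_pow_le_of_lt {a b : ℕ} (hab : a < b) :
    (16 : ℝ) ^ (a ^ 2) * ((1 / 4) ^ (a ^ 2) * (1 / 4) ^ (b ^ 2)) ≤ (1 / 2) ^ a * (1 / 2) ^ b := by
  have h1 : (16 : ℝ) ^ (a ^ 2) * ((1 / 4) ^ (a ^ 2) * (1 / 4) ^ (b ^ 2)) =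
      (1 / 2) ^ (2 * (b ^ 2 - a ^ 2)) := by
    have hb : b ^ 2 = a ^ 2 + (b ^ 2 - a ^ 2) := by
      have := Nat.pow_le_pow_left hab.le 2
      omega
    rw [pow_mul, ← mul_assoc, ← mul_pow]
    conv_lhs => rw [hb, pow_add, ← mul_assoc, ← mul_pow]
    norm_num
  rw [h1, ← pow_add]
  refine pow_le_pow_of_le_one (by norm_num) (by norm_num) ?_
  rw [Nat.sq_sub_sq]
  have : 1 ≤ b - a := by omega
  nlinarith

namespace SpecialChain

variable {B : Set (Finset Ordinal)} {h : Finset Ordinal → ℕ} {U V : ℕ → Finset Ordinal}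
  {k l : ℕ}

theorem card_inter_mul_le (hU : SpecialChain B h U k) (hV : SpecialChain B h V l) {i j : ℕ}
    (hi : i < k) (hj : j < l) (hne : h (U i) ≠ h (V j)) :
    (((U (i + 1) \ U i) ∩ (V (j + 1) \ V j)).card : ℝ) *
      ((1 / 4) ^ (h (U i) ^ 2) * (1 / 4) ^ (h (V j) ^ 2)) ≤
      (1 / 2) ^ h (U i) * (1 / 2) ^ h (V j) := by
  have h1 : (((U (i + 1) \ U i) ∩ (V (j + 1) \ V j)).card : ℝ) ≤ 16 ^ (h (U i) ^ 2) := by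
    have := card_le_card (inter_subset_left (s₁ := U (i + 1) \ U i) (s₂ := V (j + 1) \ V j))
    rw [hU.card i hi] at this
    exact_mod_cast this
  have h2 : (((U (i + 1) \ U i) ∩ (V (j + 1) \ V j)).card : ℝ) ≤ 16 ^ (h (V j) ^ 2) := by
    have := card_le_card (inter_subset_right (s₁ := U (i + 1) \ U i) (s₂ := V (j + 1) \ V j))
    rw [hV.card j hj] at this
    exact_mod_cast this
  rcases lt_or_gt_of_ne hne with hlt | hlt
  · exact (mul_le_mul_of_nonneg_right h1 (by positivity)).trans (pow_mul_pow_le_of_lt hlt)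
  · rw [mul_comm ((1 / 4 : ℝ) ^ _), mul_comm ((1 / 2 : ℝ) ^ _)]
    exact (mul_le_mul_of_nonneg_right h2 (by positivity)).trans (pow_mul_pow_le_of_lt hlt)

theorem abs_sum_alternating_le {n : ℕ} (hU : SpecialChain B h U k) (hV : SpecialChain B h V l)
    (hh : ∀ s, s.card ≤ h s) (hd : ∀ s ∈ B, ∀ t ∈ B, h s = h t → DeltaPos n s t)
    (lam : Ordinal) :
    |∑ γ ∈ (U k).filter (· < lam),
      chainFun h U k (fun i => (-1) ^ i) γ * chainFun h V l 1 γ| ≤ n + 6 := by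
  obtain ⟨W, J, S, hWU, hWV, hJ, hS, hcov⟩ := hU.exists_cover hV hh hd
  set T := (U k).filter (· < lam) with hT
  set F : Ordinal → ℝ := fun γ => chainFun h U k (fun i => (-1) ^ i) γ * chainFun h V l 1 γ
    with hF
  have hTW : T.filter (· ∈ W) = W.filter (· < lam) := by
    ext γ
    simp only [hT, mem_filter]
    have := @hWU.1 γ
    tauto
  have hWsum : |∑ γ ∈ T.filter (· ∈ W), F γ| ≤ 1 := by
    rw [hTW]
    exact hU.abs_sum_initSeg_le hV (hWU.filter_lt lam) (hWV.filter_lt lam)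
  set D : Ordinal → ℝ := fun γ => ∑ i ∈ range k, ∑ j ∈ range l,
    if h (U i) ≠ h (V j) ∧ γ ∈ (U (i + 1) \ U i) ∩ (V (j + 1) \ V j) then
      (1 / 4 : ℝ) ^ (h (U i) ^ 2) * (1 / 4) ^ (h (V j) ^ 2) else 0 with hD
  have hD0 : ∀ γ, 0 ≤ D γ := fun γ =>
    sum_nonneg fun i _ => sum_nonneg fun j _ => by split_ifs <;> positivity
  have hF1 : ∀ γ, |F γ| ≤ 1 := fun γ => by
    simp only [hF]
    rw [abs_mul]
    exact mul_le_one₀ (hU.abs_chainFun_le_one (fun i => by simp) γ) (abs_nonneg _)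
      (hV.abs_chainFun_le_one (fun i => by simp) γ)
  have hpt : ∀ γ ∈ T.filter (· ∉ W),
      |F γ| ≤ D γ + (if γ ∈ J then 1 else 0) + (if γ ∈ S then |F γ| else 0) := by
    intro γ hγ
    rw [mem_filter, hT, mem_filter] at hγ
    have hJ0 : (0 : ℝ) ≤ if γ ∈ J then 1 else 0 := by split_ifs <;> norm_num
    have hS0 : (0 : ℝ) ≤ if γ ∈ S then |F γ| else 0 := by split_ifs <;> positivity
    have hDγ := hD0 γ
    by_cases hγV : γ ∈ V l
    swap
    · have : F γ = 0 := by simp only [hF]; rw [hV.chainFun_eq_zero _ hγV, mul_zero]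
      rw [this, abs_zero] at *
      positivity
    obtain ⟨i, hi, hm⟩ := hU.exists_mem_block hγ.1.1
    obtain ⟨j, hj, hm'⟩ := hV.exists_mem_block hγV
    by_cases hij : h (U i) = h (V j)
    · rcases hcov i hi j hj hij γ hm hm' with hw | hw | hw
      · exact absurd hw hγ.2
      · rw [if_pos hw] at *
        linarith [hF1 γ]
      · rw [if_pos hw] at *
        linarith
    · have : |F γ| ≤ D γ := by
        have hFe : |F γ| = (1 / 4 : ℝ) ^ (h (U i) ^ 2) * (1 / 4) ^ (h (V j) ^ 2) := by
          simp only [hF]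
          rw [hU.chainFun_eq _ hi hm, hV.chainFun_eq _ hj hm', Pi.one_apply, one_mul, abs_mul,
            abs_mul, abs_pow, abs_neg, abs_one, one_pow, one_mul,
            abs_of_nonneg (by positivity : (0 : ℝ) ≤ (1 / 4) ^ (h (U i) ^ 2)),
            abs_of_nonneg (by positivity)]
        have hin : ∀ i', 0 ≤ ∑ j ∈ range l,
            if h (U i') ≠ h (V j) ∧ γ ∈ (U (i' + 1) \ U i') ∩ (V (j + 1) \ V j) then
            (1 / 4 : ℝ) ^ (h (U i') ^ 2) * (1 / 4) ^ (h (V j) ^ 2) else 0 := fun i' =>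
          sum_nonneg fun j _ => by split_ifs <;> positivity
        calc |F γ| = if h (U i) ≠ h (V j) ∧ γ ∈ (U (i + 1) \ U i) ∩ (V (j + 1) \ V j) then
            (1 / 4 : ℝ) ^ (h (U i) ^ 2) * (1 / 4) ^ (h (V j) ^ 2) else 0 := by
              rw [if_pos ⟨hij, mem_inter.2 ⟨hm, hm'⟩⟩, hFe]
          _ ≤ ∑ j ∈ range l,
            if h (U i) ≠ h (V j) ∧ γ ∈ (U (i + 1) \ U i) ∩ (V (j + 1) \ V j) then
            (1 / 4 : ℝ) ^ (h (U i) ^ 2) * (1 / 4) ^ (h (V j) ^ 2) else 0 :=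
              single_le_sum (f := fun j =>
                if h (U i) ≠ h (V j) ∧ γ ∈ (U (i + 1) \ U i) ∩ (V (j + 1) \ V j) then
                (1 / 4 : ℝ) ^ (h (U i) ^ 2) * (1 / 4) ^ (h (V j) ^ 2) else 0)
                (fun j _ => by split_ifs <;> positivity) (mem_range.2 hj)
          _ ≤ D γ := single_le_sum (f := fun i' => ∑ j ∈ range l,
            if h (U i') ≠ h (V j) ∧ γ ∈ (U (i' + 1) \ U i') ∩ (V (j + 1) \ V j) then
            (1 / 4 : ℝ) ^ (h (U i') ^ 2) * (1 / 4) ^ (h (V j) ^ 2) else 0)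
            (fun i' _ => hin i') (mem_range.2 hi)
      linarith
  have hDsum : ∑ γ ∈ T.filter (· ∉ W), D γ ≤ 4 := by
    calc ∑ γ ∈ T.filter (· ∉ W), D γ = ∑ i ∈ range k, ∑ j ∈ range l,
          ∑ γ ∈ T.filter (· ∉ W),
          if h (U i) ≠ h (V j) ∧ γ ∈ (U (i + 1) \ U i) ∩ (V (j + 1) \ V j) then
          (1 / 4 : ℝ) ^ (h (U i) ^ 2) * (1 / 4) ^ (h (V j) ^ 2) else 0 := by
          simp only [hD]
          rw [sum_comm]
          exact sum_congr rfl fun i _ => sum_comm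
      _ ≤ ∑ i ∈ range k, ∑ j ∈ range l, (1 / 2 : ℝ) ^ h (U i) * (1 / 2) ^ h (V j) := by
          refine sum_le_sum fun i hi => sum_le_sum fun j hj => ?_
          by_cases hne : h (U i) = h (V j)
          · rw [sum_eq_zero fun γ _ => if_neg fun hc => hc.1 hne]
            positivity
          · refine le_trans ?_
              (hU.card_inter_mul_le hV (mem_range.1 hi) (mem_range.1 hj) hne)
            rw [← sum_filter, sum_const, nsmul_eq_mul]
            refine mul_le_mul_of_nonneg_right ?_ (by positivity)
            exact Nat.cast_le.2 (card_le_card fun γ hγ => (mem_filter.1 hγ).2.2)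
      _ = (∑ i ∈ range k, (1 / 2 : ℝ) ^ h (U i)) * ∑ j ∈ range l, (1 / 2 : ℝ) ^ h (V j) := by
          rw [sum_mul_sum]
      _ ≤ 2 * 2 := mul_le_mul (hU.sum_pow_code_le hh) (hV.sum_pow_code_le hh)
          (sum_nonneg fun _ _ => by positivity) (by norm_num)
      _ = 4 := by norm_num
  have hJsum : ∑ γ ∈ T.filter (· ∉ W), (if γ ∈ J then (1 : ℝ) else 0) ≤ n := by
    rw [← sum_filter, sum_const, nsmul_eq_mul, mul_one]
    exact_mod_cast (card_le_card fun γ hγ => (mem_filter.1 hγ).2).trans hJ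
  have hSsum : ∑ γ ∈ T.filter (· ∉ W), (if γ ∈ S then |F γ| else 0) ≤ 1 := by
    rw [← sum_filter]
    exact (sum_le_sum_of_subset_of_nonneg (fun γ hγ => (mem_filter.1 hγ).2)
      fun γ _ _ => abs_nonneg _).trans hS
  calc |∑ γ ∈ T, F γ|
      = |∑ γ ∈ T.filter (· ∈ W), F γ + ∑ γ ∈ T.filter (· ∉ W), F γ| := by
        rw [sum_filter_add_sum_filter_not]
    _ ≤ |∑ γ ∈ T.filter (· ∈ W), F γ| + |∑ γ ∈ T.filter (· ∉ W), F γ| := abs_add_le _ _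
    _ ≤ 1 + ∑ γ ∈ T.filter (· ∉ W),
        (D γ + (if γ ∈ J then 1 else 0) + (if γ ∈ S then |F γ| else 0)) :=
        add_le_add hWsum ((abs_sum_le_sum_abs _ _).trans (sum_le_sum hpt))
    _ ≤ n + 6 := by
        rw [sum_add_distrib, sum_add_distrib]
        linarith

/-- A special functional is small on averages over large finite sets. -/
theorem sum_abs_chainFun_le (hU : SpecialChain B h U k) (hh : ∀ s, s.card ≤ h s)
    {F : Finset Ordinal} {r : ℕ} (hF : F.card = 16 ^ r) :
    ∑ γ ∈ F, |chainFun h U k 1 γ| ≤ 2 * 8 ^ r := by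
  have hpos : ∀ γ, |chainFun h U k 1 γ| = chainFun h U k 1 γ := fun γ =>
    abs_of_nonneg (sum_nonneg fun i _ => by
      rw [Pi.one_apply, one_mul]; split_ifs <;> positivity)
  calc ∑ γ ∈ F, |chainFun h U k 1 γ| = ∑ i ∈ range k, ∑ γ ∈ F,
        (if γ ∈ U (i + 1) \ U i then (1 / 4 : ℝ) ^ (h (U i) ^ 2) else 0) := by
        simp only [hpos]
        simp only [chainFun, Pi.one_apply, one_mul]
        exact sum_comm
    _ ≤ ∑ i ∈ range k, 8 ^ r * (1 / 2 : ℝ) ^ h (U i) := by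
        refine sum_le_sum fun i hi => ?_
        rw [← sum_filter, sum_const, nsmul_eq_mul]
        have h1 : ((F.filter (· ∈ U (i + 1) \ U i)).card : ℝ) ≤ 16 ^ (h (U i) ^ 2) := by
          have := card_le_card (s := F.filter (· ∈ U (i + 1) \ U i)) (t := U (i + 1) \ U i)
            fun γ hγ => (mem_filter.1 hγ).2
          rw [hU.card i (mem_range.1 hi)] at this
          exact_mod_cast this
        have h2 : ((F.filter (· ∈ U (i + 1) \ U i)).card : ℝ) ≤ 16 ^ r := by
          have := card_le_card (filter_subset (· ∈ U (i + 1) \ U i) F)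
          rw [hF] at this
          exact_mod_cast this
        have h3 : (1 / 2 : ℝ) ^ (h (U i) ^ 2) ≤ (1 / 2) ^ h (U i) :=
          pow_le_pow_of_le_one (by norm_num) (by norm_num) (Nat.le_self_pow two_ne_zero _)
        refine le_trans ?_ (mul_le_mul_of_nonneg_left h3 (by positivity))
        generalize h (U i) ^ 2 = g at *
        have e1 : (1 / 4 : ℝ) ^ g = (1 / 2) ^ g * (1 / 2) ^ g := by rw [← mul_pow]; norm_num
        rw [e1, ← mul_assoc]
        refine mul_le_mul_of_nonneg_right ?_ (by positivity)
        rcases le_total g r with hgr | hgr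
        · calc _ ≤ (16 : ℝ) ^ g * (1 / 2) ^ g := mul_le_mul_of_nonneg_right h1 (by positivity)
            _ = 8 ^ g := by rw [← mul_pow]; norm_num
            _ ≤ 8 ^ r := pow_le_pow_right₀ (by norm_num) hgr
        · calc _ ≤ (16 : ℝ) ^ r * (1 / 2) ^ g := mul_le_mul_of_nonneg_right h2 (by positivity)
            _ ≤ 16 ^ r * (1 / 2) ^ r := mul_le_mul_of_nonneg_left
                (pow_le_pow_of_le_one (by norm_num) (by norm_num) hgr) (by positivity)
            _ = 8 ^ r := by rw [← mul_pow]; norm_num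
    _ ≤ 8 ^ r * 2 := by
        rw [← mul_sum]
        exact mul_le_mul_of_nonneg_left (hU.sum_pow_code_le hh) (by positivity)
    _ = 2 * 8 ^ r := mul_comm _ _

/-- Along even blocks, the alternating vector and the special functional of a chain pair to
the number of blocks. -/
theorem sum_even_blocks (q : ℕ) (hU : SpecialChain B h U (2 * q)) :
    ∑ γ ∈ (U (2 * q)).filter (fun γ => ∃ i < q, γ ∈ U (2 * i + 1) \ U (2 * i)),
      chainFun h U (2 * q) (fun i => (-1) ^ i) γ * chainFun h U (2 * q) 1 γ = q := by
  have hset : (U (2 * q)).filter (fun γ => ∃ i < q, γ ∈ U (2 * i + 1) \ U (2 * i)) =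
      (range q).biUnion fun i => U (2 * i + 1) \ U (2 * i) := by
    ext γ
    simp only [mem_filter, mem_biUnion, mem_range, and_iff_right_iff_imp]
    rintro ⟨i, hi, hm⟩
    exact (hU.initSeg (by omega : 2 * i + 1 ≤ 2 * q) le_rfl).1 (mem_sdiff.1 hm).1
  rw [hset, sum_biUnion]
  · have : ∀ i ∈ range q, ∑ γ ∈ U (2 * i + 1) \ U (2 * i),
        chainFun h U (2 * q) (fun i => (-1) ^ i) γ * chainFun h U (2 * q) 1 γ = 1 := by
      intro i hi
      rw [mem_range] at hi
      rw [sum_congr rfl (g := fun _ => (1 / 16 : ℝ) ^ (h (U (2 * i)) ^ 2)) fun γ hγ => ?_]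
      · rw [sum_const, hU.card _ (by omega), nsmul_eq_mul]
        push_cast
        rw [← mul_pow]
        norm_num
      · rw [hU.chainFun_eq _ (by omega) hγ, hU.chainFun_eq _ (by omega) hγ, Pi.one_apply,
          one_mul, mul_assoc, ← mul_pow, pow_mul]
        norm_num
    rw [sum_congr rfl this]
    simp
  · intro i hi j hj hne
    simp only [coe_range, Set.mem_Iio] at hi hj
    refine disjoint_left.2 fun γ hγi hγj => hne ?_
    have := hU.block_unique (by omega) (by omega) hγi hγj
    omega

end SpecialChain

/-- An infinite set of ordinals contains a strictly increasing sequence. -/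
theorem exists_strictMono_mem {A : Set Ordinal} (hA : A.Infinite) :
    ∃ e : ℕ → Ordinal, StrictMono e ∧ ∀ i, e i ∈ A := by
  have f := hA.natEmbedding
  obtain ⟨g, hg | hg⟩ := exists_increasing_or_nonincreasing_subseq (· < ·)
    fun i => (f i : Ordinal)
  · exact ⟨fun i => f (g i), fun i j hij => hg i j hij, fun i => (f (g i)).2⟩
  · exfalso
    refine (RelEmbedding.natGT (r := ((· < ·) : Ordinal → Ordinal → Prop))
      (fun i => (f (g i) : Ordinal)) fun i => ?_).not_wellFounded wellFounded_lt
    refine lt_of_le_of_ne (not_lt.1 (hg i (i + 1) (Nat.lt_succ_self i))) fun heq => ?_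
    have := g.injective (f.injective (Subtype.ext heq))
    omega

/-- Special chains of every length exist inside an infinite set whose finite subsets all belong
to the family. -/
theorem exists_specialChain {B : Set (Finset Ordinal)} (h : Finset Ordinal → ℕ)
    {A : Set Ordinal} (hA : A.Infinite) (hAB : ∀ s : Finset Ordinal, ↑s ⊆ A → s ∈ B) :
    ∃ U : ℕ → Finset Ordinal, (∀ i, ↑(U i) ⊆ A) ∧ ∀ k, SpecialChain B h U k := by
  obtain ⟨e, he, heA⟩ := exists_strictMono_mem hA
  let p : ℕ → ℕ := fun i => Nat.rec 0 (fun _ m => m + 16 ^ (h ((range m).image e) ^ 2)) i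
  have hp : ∀ i, p (i + 1) = p i + 16 ^ (h ((range (p i)).image e) ^ 2) := fun i => rfl
  have hsub : ∀ i, (range (p i)).image e ⊆ (range (p (i + 1))).image e := fun i =>
    image_subset_image (range_subset_range.2 (by rw [hp]; exact Nat.le_add_right _ _))
  have hUA : ∀ i, ↑((range (p i)).image e) ⊆ A := fun i x hx => by
    simp only [coe_image, Set.mem_image] at hx
    obtain ⟨m, -, rfl⟩ := hx
    exact heA m
  refine ⟨fun i => (range (p i)).image e, hUA, fun k => ⟨by simp [p], ?_, ?_, ?_⟩⟩
  · refine fun i _ => ⟨hsub i, fun a ha b hb => ?_⟩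
    simp only [mem_sdiff, mem_image, mem_range, not_exists, not_and] at ha hb
    obtain ⟨a, ha, rfl⟩ := ha
    obtain ⟨⟨b, -, rfl⟩, hb⟩ := hb
    exact he (ha.trans_le (not_lt.1 fun hlt => hb b hlt rfl))
  · intro i _
    rw [card_sdiff_of_subset (hsub i), card_image_of_injective _ he.injective,
      card_image_of_injective _ he.injective, card_range, card_range, hp, Nat.add_sub_cancel_left]
  · exact fun i _ => hAB _ (hUA i)

/-! ### Norms on finitely supported functions given by a family of functionals -/

/-- The supremum over `w ∈ Φ` of the absolute value of the functional with coefficients `w`. -/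
noncomputable def supNorm {ι : Type*} (Φ : Set (ι → ℝ)) (x : ι →₀ ℝ) : ℝ :=
  ⨆ w : Φ, |Finsupp.linearCombination ℝ (w : ι → ℝ) x|

section SupNorm

variable {ι : Type*} {Φ : Set (ι → ℝ)}

theorem le_supNorm (hΦ : ∀ w ∈ Φ, ∀ γ, |w γ| ≤ 1) {w : ι → ℝ} (hw : w ∈ Φ) (x : ι →₀ ℝ) :
    |Finsupp.linearCombination ℝ w x| ≤ supNorm Φ x := by
  refine le_ciSup (f := fun w : Φ => |Finsupp.linearCombination ℝ (w : ι → ℝ) x|)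
    ⟨∑ γ ∈ x.support, |x γ|, ?_⟩ ⟨w, hw⟩
  rintro _ ⟨⟨v, hv⟩, rfl⟩
  simp only [Finsupp.linearCombination_apply, Finsupp.sum]
  refine (abs_sum_le_sum_abs _ _).trans (sum_le_sum fun γ _ => ?_)
  rw [smul_eq_mul, abs_mul]
  exact mul_le_of_le_one_right (abs_nonneg _) (hΦ v hv γ)

theorem supNorm_le {x : ι →₀ ℝ} {C : ℝ} (hC : 0 ≤ C)
    (h : ∀ w ∈ Φ, |Finsupp.linearCombination ℝ w x| ≤ C) : supNorm Φ x ≤ C :=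
  Real.iSup_le (fun w => h w w.2) hC

theorem supNorm_nonneg (x : ι →₀ ℝ) : 0 ≤ supNorm Φ x :=
  Real.iSup_nonneg fun _ => abs_nonneg _

theorem supNorm_smul (r : ℝ) (x : ι →₀ ℝ) : supNorm Φ (r • x) = |r| * supNorm Φ x := by
  simp only [supNorm, map_smul, smul_eq_mul, abs_mul]
  rw [Real.mul_iSup_of_nonneg (abs_nonneg r)]

theorem supNorm_add_le (hΦ : ∀ w ∈ Φ, ∀ γ, |w γ| ≤ 1) (x y : ι →₀ ℝ) :
    supNorm Φ (x + y) ≤ supNorm Φ x + supNorm Φ y := by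
  refine supNorm_le (add_nonneg (supNorm_nonneg x) (supNorm_nonneg y)) fun w hw => ?_
  rw [map_add]
  exact (abs_add_le _ _).trans (add_le_add (le_supNorm hΦ hw x) (le_supNorm hΦ hw y))

theorem linearCombination_pi_single [DecidableEq ι] (γ : ι) (x : ι →₀ ℝ) :
    Finsupp.linearCombination ℝ (Pi.single γ 1 : ι → ℝ) x = x γ := by
  rw [Finsupp.linearCombination_apply, Finsupp.sum, sum_eq_single γ]
  · simp
  · intro b _ hb; simp [hb]
  · intro hγ; simp [Finsupp.notMem_support_iff.1 hγ]

theorem linearCombination_sum_smul_single (w a : ι → ℝ) (s : Finset ι) :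
    Finsupp.linearCombination ℝ w (∑ γ ∈ s, a γ • Finsupp.single γ (1 : ℝ)) =
      ∑ γ ∈ s, a γ * w γ := by
  simp [map_sum, Finsupp.linearCombination_single]

theorem linearCombination_filter (w : ι → ℝ) (p : ι → Prop) [DecidablePred p] (x : ι →₀ ℝ) :
    Finsupp.linearCombination ℝ w (x.filter p) =
      Finsupp.linearCombination ℝ (fun γ => if p γ then w γ else 0) x := by
  simp only [Finsupp.linearCombination_apply, Finsupp.sum, Finsupp.support_filter, sum_filter]
  refine sum_congr rfl fun γ _ => ?_
  by_cases hp : p γ <;> simp [hp]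

theorem supNorm_eq_zero_iff [DecidableEq ι] (hΦ : ∀ w ∈ Φ, ∀ γ, |w γ| ≤ 1)
    (hδ : ∀ γ, (Pi.single γ 1 : ι → ℝ) ∈ Φ) (x : ι →₀ ℝ) : supNorm Φ x = 0 ↔ x = 0 := by
  constructor
  · intro h0
    ext γ
    have := le_supNorm hΦ (hδ γ) x
    rw [h0, linearCombination_pi_single] at this
    simpa using this
  · rintro rfl
    simp [supNorm]

theorem supNorm_single [DecidableEq ι] (hΦ : ∀ w ∈ Φ, ∀ γ, |w γ| ≤ 1)
    (hδ : ∀ γ, (Pi.single γ 1 : ι → ℝ) ∈ Φ) (γ : ι) :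
    supNorm Φ (Finsupp.single γ 1) = 1 := by
  refine le_antisymm (supNorm_le zero_le_one fun w hw => ?_) ?_
  · simpa [Finsupp.linearCombination_single] using hΦ w hw γ
  · have := le_supNorm hΦ (hδ γ) (Finsupp.single γ 1)
    rw [linearCombination_pi_single] at this
    simpa using this

theorem supNorm_filter_le (hΦ : ∀ w ∈ Φ, ∀ γ, |w γ| ≤ 1) {p : ι → Prop} [DecidablePred p]
    (hp : ∀ w ∈ Φ, (fun γ => if p γ then w γ else 0) ∈ Φ) (x : ι →₀ ℝ) :
    supNorm Φ (x.filter p) ≤ supNorm Φ x := by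
  refine supNorm_le (supNorm_nonneg x) fun w hw => ?_
  rw [linearCombination_filter]
  exact le_supNorm hΦ (hp w hw) x

/-- The unit vectors are weakly null as soon as the functionals are uniformly small on averages
over large finite sets. -/
theorem finite_of_le_supNorm
    (havg : ∀ w ∈ Φ, ∀ (r : ℕ) (F : Finset ι), F.card = 16 ^ r → ∑ γ ∈ F, |w γ| ≤ 2 * 8 ^ r)
    (f : (ι →₀ ℝ) →ₗ[ℝ] ℝ) {C : ℝ} (hC : ∀ x, |f x| ≤ C * supNorm Φ x) {ε : ℝ} (hε : 0 < ε) :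
    {γ | ε ≤ |f (Finsupp.single γ 1)|}.Finite := by
  by_contra hinf
  obtain ⟨r, hr⟩ := pow_unbounded_of_one_lt (2 * |C| / ε) (by norm_num : (1 : ℝ) < 2)
  obtain ⟨F, hF, hcard⟩ := Set.Infinite.exists_subset_card_eq hinf (16 ^ r)
  set a : ι → ℝ := fun γ => SignType.sign (f (Finsupp.single γ 1)) with ha
  have ha1 : ∀ γ, |a γ| ≤ 1 := fun γ => by
    simp only [ha]
    rcases SignType.sign (f (Finsupp.single γ 1)) <;> simp
  set x : ι →₀ ℝ := ∑ γ ∈ F, a γ • Finsupp.single γ (1 : ℝ) with hx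
  have hfx : ε * 16 ^ r ≤ f x := by
    have : f x = ∑ γ ∈ F, |f (Finsupp.single γ 1)| := by
      rw [hx, map_sum]
      refine sum_congr rfl fun γ _ => ?_
      rw [map_smul, smul_eq_mul, ha]
      exact sign_mul_self _
    rw [this]
    calc ε * 16 ^ r = ∑ _γ ∈ F, ε := by
          rw [sum_const, hcard, nsmul_eq_mul]; push_cast; ring
      _ ≤ _ := sum_le_sum fun γ hγ => hF hγ
  have hNx : supNorm Φ x ≤ 2 * 8 ^ r := by
    refine supNorm_le (by positivity) fun w hw => ?_
    rw [hx, linearCombination_sum_smul_single]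
    refine (abs_sum_le_sum_abs _ _).trans (le_trans (sum_le_sum fun γ _ => ?_)
      (havg w hw r F hcard))
    rw [abs_mul]
    exact mul_le_of_le_one_left (abs_nonneg _) (ha1 γ)
  have h1 : ε * 16 ^ r ≤ |C| * (2 * 8 ^ r) :=
    calc ε * 16 ^ r ≤ |f x| := hfx.trans (le_abs_self _)
      _ ≤ C * supNorm Φ x := hC x
      _ ≤ |C| * supNorm Φ x := mul_le_mul_of_nonneg_right (le_abs_self C) (supNorm_nonneg x)
      _ ≤ |C| * (2 * 8 ^ r) := mul_le_mul_of_nonneg_left hNx (abs_nonneg C)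
  rw [div_lt_iff₀ hε] at hr
  have h16 : (16 : ℝ) ^ r = 2 ^ r * 8 ^ r := by rw [← mul_pow]; norm_num
  rw [h16] at h1
  have h8 : (0 : ℝ) < 8 ^ r := by positivity
  nlinarith

end SupNorm

/-! ### The family of special functionals -/

/-- The coordinate functionals together with the truncations of the functionals carried by
special chains. -/
def specialFunctionals (o : Ordinal) (B : Set (Finset Ordinal)) (h : Finset Ordinal → ℕ) :
    Set ({α : Ordinal // α < o} → ℝ) :=
  {w | (∃ γ, w = Pi.single γ 1) ∨
    ∃ (U : ℕ → Finset Ordinal) (k : ℕ) (lam : Ordinal), SpecialChain B h U k ∧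
      w = fun γ => if γ.1 < lam then chainFun h U k 1 γ.1 else 0}

section SpecialFunctionals

universe u

variable {o : Ordinal.{u}} {B : Set (Finset Ordinal.{u})} {h : Finset Ordinal.{u} → ℕ}

theorem zero_mem_specialFunctionals : (fun _ => 0) ∈ specialFunctionals o B h :=
  Or.inr ⟨fun _ => ∅, 0, 0, ⟨rfl, by simp, by simp, by simp⟩, by simp⟩

theorem abs_le_one_of_mem_specialFunctionals {w : {α : Ordinal // α < o} → ℝ}
    (hw : w ∈ specialFunctionals o B h) (γ : {α : Ordinal // α < o}) : |w γ| ≤ 1 := by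
  rcases hw with ⟨δ, rfl⟩ | ⟨U, k, lam, hU, rfl⟩
  · by_cases hγ : γ = δ
    · subst hγ; simp
    · simp [hγ]
  · simp only
    split_ifs
    · exact hU.abs_chainFun_le_one (fun i => by simp) γ
    · simp

theorem truncate_mem_specialFunctionals {w : {α : Ordinal // α < o} → ℝ}
    (hw : w ∈ specialFunctionals o B h) (lam : Ordinal) :
    (fun γ : {α : Ordinal // α < o} => if (γ : Ordinal) < lam then w γ else 0) ∈
      specialFunctionals o B h := by
  rcases hw with ⟨δ, rfl⟩ | ⟨U, k, mu, hU, rfl⟩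
  · by_cases hδ : (δ : Ordinal) < lam
    · refine Or.inl ⟨δ, funext fun γ => ?_⟩
      by_cases hγ : γ = δ
      · subst hγ; simp [hδ]
      · simp [hγ]
    · convert zero_mem_specialFunctionals using 1
      funext γ
      by_cases hγ : γ = δ
      · subst hγ; simp [hδ]
      · simp [hγ]
  · refine Or.inr ⟨U, k, min lam mu, hU, funext fun γ => ?_⟩
    simp only [lt_min_iff, ite_and]

theorem sum_abs_le_of_mem_specialFunctionals (hh : ∀ s, s.card ≤ h s)
    {w : {α : Ordinal // α < o} → ℝ} (hw : w ∈ specialFunctionals o B h) (r : ℕ)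
    (F : Finset {α : Ordinal // α < o}) (hF : F.card = 16 ^ r) :
    ∑ γ ∈ F, |w γ| ≤ 2 * 8 ^ r := by
  rcases hw with ⟨δ, rfl⟩ | ⟨U, k, lam, hU, rfl⟩
  · calc ∑ γ ∈ F, |(Pi.single δ 1 : {α : Ordinal // α < o} → ℝ) γ|
        = ∑ γ ∈ F, if γ = δ then (1 : ℝ) else 0 := by
          refine sum_congr rfl fun γ _ => ?_
          by_cases hγ : γ = δ
          · subst hγ; simp
          · simp [hγ]
      _ ≤ 1 := by rw [sum_ite_eq']; split_ifs <;> norm_num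
      _ ≤ 2 * 8 ^ r := by linarith [one_le_pow₀ (by norm_num : (1 : ℝ) ≤ 8) (n := r)]
  · calc _ ≤ ∑ γ ∈ F, |chainFun h U k 1 (γ : Ordinal)| := by
          refine sum_le_sum fun γ _ => ?_
          dsimp only
          split_ifs
          · exact le_rfl
          · simp
      _ = ∑ γ ∈ F.map (Function.Embedding.subtype _), |chainFun h U k 1 γ| := by
          rw [sum_map]; rfl
      _ ≤ 2 * 8 ^ r := hU.sum_abs_chainFun_le hh (by rw [card_map, hF])

theorem supNorm_alternating_le {n : ℕ} {U : ℕ → Finset Ordinal} {k : ℕ}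
    (hU : SpecialChain B h U k) (hUo : ∀ γ ∈ U k, γ < o) (hh : ∀ s, s.card ≤ h s)
    (hd : ∀ s ∈ B, ∀ t ∈ B, h s = h t → DeltaPos n s t) :
    supNorm (specialFunctionals o B h) (∑ γ ∈ (U k).subtype (· < o),
      chainFun h U k (fun i => (-1) ^ i) γ • Finsupp.single γ (1 : ℝ)) ≤ n + 6 := by
  refine supNorm_le (by positivity) fun w hw => ?_
  rw [linearCombination_sum_smul_single w
    (fun γ => chainFun h U k (fun i => (-1) ^ i) (γ : Ordinal))]
  rcases hw with ⟨δ, rfl⟩ | ⟨V, l, lam, hV, rfl⟩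
  · have h1 : |chainFun h U k (fun i => (-1) ^ i) (δ : Ordinal)| ≤ 1 :=
      hU.abs_chainFun_le_one (fun i => by simp) _
    have h0 : (0 : ℝ) ≤ n := Nat.cast_nonneg n
    simp only [Pi.single_apply, mul_ite, mul_one, mul_zero, sum_ite_eq']
    split_ifs
    · linarith
    · rw [abs_zero]; linarith
  · have := hU.abs_sum_alternating_le hV hh hd lam
    rw [sum_filter, ← sum_subtype_of_mem _ hUo] at this
    simpa only [mul_ite, mul_zero] using this

theorem le_supNorm_even_blocks {U : ℕ → Finset Ordinal} (q : ℕ)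
    (hU : SpecialChain B h U (2 * q)) (hUo : ∀ γ ∈ U (2 * q), γ < o) :
    q ≤ supNorm (specialFunctionals o B h) (∑ γ ∈ ((U (2 * q)).filter
      (fun γ => ∃ i < q, γ ∈ U (2 * i + 1) \ U (2 * i))).subtype (· < o),
      chainFun h U (2 * q) (fun i => (-1) ^ i) γ • Finsupp.single γ (1 : ℝ)) := by
  refine le_trans ?_ (le_supNorm (fun w => abs_le_one_of_mem_specialFunctionals)
    (Or.inr ⟨U, 2 * q, o, hU, rfl⟩) _)
  rw [linearCombination_sum_smul_single _
    (fun γ : {α // α < o} => chainFun h U (2 * q) (fun i => (-1) ^ i) γ.1)]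
  refine le_trans (le_of_eq ?_) (le_abs_self _)
  rw [← hU.sum_even_blocks, ← sum_subtype_of_mem (p := (· < o)) _
    fun γ hγ => hUo γ (mem_filter.1 hγ).1]
  exact sum_congr rfl fun γ _ => by rw [if_pos γ.2]

end SpecialFunctionals

/-- If for some cardinal `κ` and some `n` there are a very-large family `B` of finite
subsets of `κ` and a countable coloring of `B` such that distinct sets of the same
color are in `n`-Δ-position, then there is a norm on `c₀₀(κ)` making the unit vectors
a normalized weakly null Schauder basic sequence with no infinite unconditional
subsequence. -/
theorem stmt3 (κ : Cardinal) (n : ℕ)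
    (B : Set (Finset Ordinal))
    (hBsub : ∀ s ∈ B, ∀ a ∈ s, a < κ.ord)
    (hVL : VeryLarge κ.ord B)
    (c : Finset Ordinal → ℕ)
    (hc : ∀ s ∈ B, ∀ t ∈ B, s ≠ t → c s = c t → DeltaPos n s t) :
    ∃ N : ({α : Ordinal // α < κ.ord} →₀ ℝ) → ℝ,
      -- `N` is a norm on `c₀₀(κ)`
      (∀ x, 0 ≤ N x) ∧
      (∀ x, N x = 0 ↔ x = 0) ∧
      (∀ (r : ℝ) (x), N (r • x) = |r| * N x) ∧
      (∀ x y, N (x + y) ≤ N x + N y) ∧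
      -- (i) the unit vectors are normalized
      (∀ γ, N (Finsupp.single γ 1) = 1) ∧
      -- (ii) the unit vectors are a Schauder basic sequence
      (∃ K : ℝ, 1 ≤ K ∧ ∀ lam : Ordinal, lam < κ.ord →
        ∀ x : {α : Ordinal // α < κ.ord} →₀ ℝ,
          N (x.filter fun γ => (γ : Ordinal) < lam) ≤ K * N x) ∧
      -- (iii) the unit vectors are weakly null
      (∀ f : ({α : Ordinal // α < κ.ord} →₀ ℝ) →ₗ[ℝ] ℝ,
        (∃ C : ℝ, ∀ x, |f x| ≤ C * N x) →
        ∀ ε : ℝ, 0 < ε → {γ | ε ≤ |f (Finsupp.single γ 1)|}.Finite) ∧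
      -- (iv) no infinite subsequence is unconditional
      (∀ A : Set {α : Ordinal // α < κ.ord}, A.Infinite → ∀ L : ℝ, 1 ≤ L →
        ∃ s : Finset {α : Ordinal // α < κ.ord}, ↑s ⊆ A ∧
          ∃ a : {α : Ordinal // α < κ.ord} → ℝ, ∃ t ⊆ s,
            L * N (∑ γ ∈ s, a γ • Finsupp.single γ (1 : ℝ)) <
              N (∑ γ ∈ t, a γ • Finsupp.single γ (1 : ℝ))) := by
  set h : Finset Ordinal → ℕ := fun s => Nat.pair (c s) s.card with hdef
  have hh : ∀ s, s.card ≤ h s := fun s => Nat.right_le_pair _ _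
  have hd : ∀ s ∈ B, ∀ t ∈ B, h s = h t → DeltaPos n s t := by
    intro s hs t ht hst
    by_cases heq : s = t
    · exact heq ▸ DeltaPos.refl n s
    · exact hc s hs t ht heq (Nat.pair_eq_pair.1 hst).1
  have hΦ : ∀ w ∈ specialFunctionals κ.ord B h, ∀ γ, |w γ| ≤ 1 :=
    fun w => abs_le_one_of_mem_specialFunctionals
  have hδ : ∀ γ, Pi.single γ 1 ∈ specialFunctionals κ.ord B h := fun γ => Or.inl ⟨γ, rfl⟩
  refine ⟨supNorm (specialFunctionals κ.ord B h), supNorm_nonneg, supNorm_eq_zero_iff hΦ hδ,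
    supNorm_smul, supNorm_add_le hΦ, supNorm_single hΦ hδ, ⟨1, le_rfl, fun lam _ x => ?_⟩, ?_, ?_⟩
  · rw [one_mul]
    exact supNorm_filter_le hΦ (fun w hw => truncate_mem_specialFunctionals hw lam) x
  · rintro f ⟨C, hC⟩ ε hε
    exact finite_of_le_supNorm (fun w => sum_abs_le_of_mem_specialFunctionals hh) f hC hε
  · intro A hA L hL
    obtain ⟨A', hA'A, hA', hA'B⟩ := hVL (Subtype.val '' A)
      (by rintro _ ⟨γ, -, rfl⟩; exact γ.2) (hA.image Subtype.val_injective.injOn)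
    obtain ⟨U, hUA, hU⟩ := exists_specialChain h hA' hA'B
    obtain ⟨q, hq⟩ := exists_nat_gt (L * (n + 6))
    have hUo : ∀ γ ∈ U (2 * q), γ < κ.ord := fun γ hγ => by
      obtain ⟨δ, -, rfl⟩ := hA'A (hUA _ hγ)
      exact δ.2
    refine ⟨(U (2 * q)).subtype (· < κ.ord), ?_,
      fun γ => chainFun h U (2 * q) (fun i => (-1) ^ i) γ,
      ((U (2 * q)).filter (fun γ => ∃ i < q, γ ∈ U (2 * i + 1) \ U (2 * i))).subtype
        (· < κ.ord), ?_, ?_⟩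
    · intro γ hγ
      obtain ⟨δ, hδA, hδγ⟩ := hA'A (hUA _ (mem_subtype.1 hγ))
      exact Subtype.ext hδγ ▸ hδA
    · intro γ hγ
      exact mem_subtype.2 (mem_filter.1 (mem_subtype.1 hγ)).1
    · calc _ ≤ L * (n + 6) := mul_le_mul_of_nonneg_left
            (supNorm_alternating_le (hU _) hUo hh hd) (by linarith)
        _ < q := hq
        _ ≤ _ := le_supNorm_even_blocks q (hU _) hUo
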